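/- For every γ ∈ (0,1) and every integer n ≥ 1, there exists a trigonometric polynomial q(x) = Σ_{|ℓ|<n} q̂(ℓ) e^{iℓx} such that q̂(0) = 1, ∫_{−π}^{π} |q(x)| dx ≤ C(γ), and for every s ≥ 1, ∫_{s/n ≤ |x| ≤ π} |q(x)| dx ≤ C(γ) s^{1−γ} e^{−s^γ}, where C(γ) depends only on γ. -/

import Mathlib

open MeasureTheory Real

/-- The squared modulus of `A(e^{ix})`, for a real polynomial `A` of degree `< n` with `A(1) = 1`,
is up to normalization a trigonometric polynomial of degree `< n` with constant term `1`. -/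
lemma exists_coeff_of_polynomial {n : ℕ} (hn : 1 ≤ n) (A : Polynomial ℝ) (hA : A.natDegree < n)
    (h1 : A.eval 1 = 1) :
    ∃ c : ℤ → ℂ, (∀ ℓ : ℤ, (n : ℤ) ≤ |ℓ| → c ℓ = 0) ∧ c 0 = 1 ∧
      ∀ x : ℝ, ‖∑ ℓ ∈ Finset.Icc (-(n : ℤ) + 1) ((n : ℤ) - 1),
        c ℓ * Complex.exp (Complex.I * ℓ * x)‖ ≤
          n * ‖Polynomial.aeval (Complex.exp (Complex.I * x)) A‖ ^ 2 := by
  set S : ℝ := ∑ i ∈ Finset.range n, A.coeff i ^ 2 with hS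
  have hnS : 1 ≤ n * S := by
    have h := sq_sum_le_card_mul_sum_sq (s := Finset.range n) (f := A.coeff)
    have h2 := Polynomial.eval_eq_sum_range' hA 1
    simp only [one_pow, mul_one] at h2
    rw [← h2, h1] at h
    simpa using h
  have hn0 : (0 : ℝ) < n := by exact_mod_cast hn
  have hSpos : 0 < S := by
    by_contra h
    nlinarith
  have hS0 : (S : ℂ) ≠ 0 := by exact_mod_cast hSpos.ne'
  refine ⟨fun ℓ ↦ (S : ℂ)⁻¹ * ∑ i ∈ Finset.range n, ∑ j ∈ Finset.range n,
    if (i : ℤ) - j = ℓ then (A.coeff i : ℂ) * A.coeff j else 0, ?_, ?_, ?_⟩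
  · intro ℓ hℓ
    refine mul_eq_zero_of_right _ (Finset.sum_eq_zero fun i hi ↦ Finset.sum_eq_zero fun j hj ↦ ?_)
    rw [Finset.mem_range] at hi hj
    rw [if_neg]
    rintro rfl
    rcases abs_cases ((i : ℤ) - j) with h | h <;> omega
  · have : ∀ i ∈ Finset.range n, (∑ j ∈ Finset.range n,
        if (i : ℤ) - j = 0 then (A.coeff i : ℂ) * A.coeff j else 0) = (A.coeff i : ℂ) ^ 2 := by
      intro i hi
      rw [Finset.sum_eq_single_of_mem i hi]
      · simp [sq]
      · intro j _ hj
        rw [if_neg]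
        omega
    beta_reduce
    rw [Finset.sum_congr rfl this, hS]
    push_cast
    rw [inv_mul_cancel₀]
    exact_mod_cast hS0
  · intro x
    set z := Complex.exp (Complex.I * x) with hz
    have hconj : ∀ i j : ℕ, Complex.exp (Complex.I * ((i : ℤ) - (j : ℤ) : ℤ) * x) =
        z ^ i * (starRingEnd ℂ) (z ^ j) := by
      intro i j
      rw [hz, map_pow, ← Complex.exp_conj, ← Complex.exp_nat_mul, ← Complex.exp_nat_mul,
        ← Complex.exp_add]
      congr 1
      simp
      ring
    have key : ∑ ℓ ∈ Finset.Icc (-(n : ℤ) + 1) ((n : ℤ) - 1),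
        ((S : ℂ)⁻¹ * ∑ i ∈ Finset.range n, ∑ j ∈ Finset.range n,
          if (i : ℤ) - j = ℓ then (A.coeff i : ℂ) * A.coeff j else 0) *
            Complex.exp (Complex.I * ℓ * x) =
        (S : ℂ)⁻¹ * (Polynomial.aeval z A * (starRingEnd ℂ) (Polynomial.aeval z A)) := by
      rw [Polynomial.aeval_eq_sum_range' hA, map_sum, Finset.sum_mul_sum]
      simp_rw [mul_assoc (S : ℂ)⁻¹]
      rw [← Finset.mul_sum]
      congr 1
      simp_rw [Finset.sum_mul]
      rw [Finset.sum_comm]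
      refine Finset.sum_congr rfl fun i hi ↦ ?_
      rw [Finset.sum_comm]
      refine Finset.sum_congr rfl fun j hj ↦ ?_
      rw [Finset.mem_range] at hi hj
      rw [Finset.sum_eq_single_of_mem ((i : ℤ) - j) (by rw [Finset.mem_Icc]; omega)]
      · rw [if_pos rfl, hconj]
        simp
        ring
      · intro ℓ _ hℓ
        rw [if_neg (Ne.symm hℓ), zero_mul]
    rw [key, Complex.mul_conj, norm_mul, norm_inv, Complex.norm_real, Complex.norm_real,
      Complex.normSq_eq_norm_sq, norm_of_nonneg hSpos.le, norm_of_nonneg (by positivity)]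
    gcongr
    exact (inv_le_iff_one_le_mul₀ hSpos).2 hnS

lemma integrable_exp_neg_abs_rpow {γ : ℝ} (hγ : 0 < γ) :
    Integrable fun x : ℝ ↦ exp (-|x| ^ γ) := by
  have h : IntegrableOn (fun x : ℝ ↦ exp (-|x| ^ γ)) (Set.Ioi 0) := by
    refine (integrableOn_rpow_mul_exp_neg_rpow (s := 0) (by norm_num) hγ).congr_fun
      (fun x hx ↦ ?_) measurableSet_Ioi
    simp [abs_of_pos (Set.mem_Ioi.1 hx)]
  have h' : IntegrableOn (fun x : ℝ ↦ exp (-|x| ^ γ)) (Set.Iic 0) := by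
    have hneg : MeasurableEmbedding fun x : ℝ ↦ -x := (Homeomorph.neg ℝ).measurableEmbedding
    rw [← Measure.map_neg_eq_self (volume : Measure ℝ)]
    rw [hneg.integrableOn_map_iff]
    simpa [Function.comp_def, integrableOn_Ici_iff_integrableOn_Ioi] using h
  rw [← integrableOn_univ, ← Set.Iic_union_Ioi (a := (0 : ℝ))]
  exact h'.union h

lemma exists_rpow_le_mul_rpow_add {γ β : ℝ} (hγ : 0 < γ) (hβ : γ < β) {c : ℝ} (hc : 0 < c) :
    ∃ D : ℝ, ∀ t : ℝ, 0 ≤ t → t ^ γ ≤ c * t ^ β + D := by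
  set t₀ := c⁻¹ ^ (β - γ)⁻¹ with ht₀
  have ht₀pos : 0 < t₀ := by positivity
  refine ⟨t₀ ^ γ, fun t ht ↦ ?_⟩
  rcases le_total t t₀ with h | h
  · have := rpow_le_rpow ht h hγ.le
    have : 0 ≤ c * t ^ β := by positivity
    linarith
  · have htpos : 0 < t := ht₀pos.trans_le h
    have h1 : c⁻¹ ≤ t ^ (β - γ) := by
      have := rpow_le_rpow ht₀pos.le h (sub_nonneg.2 hβ.le)
      rwa [ht₀, ← rpow_mul (by positivity), inv_mul_cancel₀ (sub_pos.2 hβ).ne', rpow_one] at this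
    have h2 : 1 ≤ c * t ^ (β - γ) := by
      rw [← mul_inv_cancel₀ hc.ne']
      gcongr
    have h3 : t ^ β = t ^ (β - γ) * t ^ γ := by
      rw [← rpow_add htpos]
      ring_nf
    have h4 : 0 < t ^ γ := by positivity
    have h5 : 0 < t₀ ^ γ := by positivity
    rw [h3]
    nlinarith

/-- The average of the first `m` monomials. -/
noncomputable def averagePolynomial (m : ℕ) : Polynomial ℝ :=
  Polynomial.C (m : ℝ)⁻¹ * ∑ i ∈ Finset.range m, Polynomial.X ^ i

lemma natDegree_averagePolynomial_le (m : ℕ) : (averagePolynomial m).natDegree ≤ m - 1 := by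
  refine (Polynomial.natDegree_C_mul_le _ _).trans ?_
  refine Polynomial.natDegree_sum_le_of_forall_le _ _ fun i hi ↦ ?_
  rw [Polynomial.natDegree_X_pow]
  rw [Finset.mem_range] at hi
  omega

lemma eval_one_averagePolynomial {m : ℕ} (hm : m ≠ 0) : (averagePolynomial m).eval 1 = 1 := by
  have : (m : ℝ) ≠ 0 := by exact_mod_cast hm
  simp [averagePolynomial, Polynomial.eval_finsetSum, this]

lemma aeval_averagePolynomial (m : ℕ) (z : ℂ) :
    Polynomial.aeval z (averagePolynomial m) = (m : ℂ)⁻¹ * ∑ i ∈ Finset.range m, z ^ i := by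
  simp [averagePolynomial]

lemma norm_aeval_averagePolynomial_le_one (m : ℕ) {z : ℂ} (hz : ‖z‖ = 1) :
    ‖Polynomial.aeval z (averagePolynomial m)‖ ≤ 1 := by
  rw [aeval_averagePolynomial, norm_mul, norm_inv, Complex.norm_natCast]
  have : ‖∑ i ∈ Finset.range m, z ^ i‖ ≤ m := by
    refine (norm_sum_le _ _).trans ?_
    simp [hz]
  rcases eq_or_ne m 0 with rfl | hm
  · simp
  · have : (0 : ℝ) < m := by positivity
    rw [inv_mul_le_iff₀ this]
    linarith

lemma norm_aeval_averagePolynomial_le {m : ℕ} (hm : m ≠ 0) {x : ℝ} (hx0 : x ≠ 0) (hx : |x| ≤ π) :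
    ‖Polynomial.aeval (Complex.exp (Complex.I * x)) (averagePolynomial m)‖ ≤ π / (m * |x|) := by
  set z := Complex.exp (Complex.I * x) with hzdef
  have hz : ‖z‖ = 1 := Complex.norm_exp_I_mul_ofReal x
  have hxpos : 0 < |x| := abs_pos.2 hx0
  have hlow : 2 / π * |x| ≤ ‖z - 1‖ := by
    rw [hzdef, Complex.norm_exp_I_mul_ofReal_sub_one, norm_mul, Real.norm_eq_abs, Real.norm_eq_abs]
    have h := mul_le_sin (x := |x| / 2) (by positivity) (by linarith)
    have h2 : sin (|x| / 2) ≤ |sin (x / 2)| := by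
      rcases abs_cases x with h | h
      · rw [h.1]
        exact le_abs_self _
      · rw [h.1, neg_div, sin_neg]
        exact neg_le_abs _
    rw [abs_two]
    linarith
  have hm' : (0 : ℝ) < m := by positivity
  have hpos : 0 < 2 / π * |x| := by positivity
  have hz1 : z ≠ 1 := by
    intro h
    rw [h, sub_self, norm_zero] at hlow
    linarith
  rw [aeval_averagePolynomial, geom_sum_eq hz1, norm_mul, norm_inv, Complex.norm_natCast, norm_div]
  have h2 : ‖z ^ m - 1‖ ≤ 2 := by
    refine (norm_sub_le _ _).trans ?_
    rw [norm_pow, hz, one_pow, norm_one]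
    norm_num
  calc (m : ℝ)⁻¹ * (‖z ^ m - 1‖ / ‖z - 1‖) ≤ (m : ℝ)⁻¹ * (2 / (2 / π * |x|)) := by gcongr
    _ = π / (m * |x|) := by field_simp

/-- A product of averages over lengths `≈ n / (k + 1) ^ r` with `r > 1` has degree `< n`, and on the
unit circle it decays like `exp (-|n x| ^ γ)` away from `x = 0`. -/
lemma exists_polynomial_norm_sq_le {γ : ℝ} (hγ : γ ∈ Set.Ioo (0 : ℝ) 1) :
    ∃ M : ℝ, 0 < M ∧ ∀ n : ℕ, 1 ≤ n → ∃ A : Polynomial ℝ, A.natDegree < n ∧ A.eval 1 = 1 ∧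
      ∀ x : ℝ, |x| ≤ π → ‖Polynomial.aeval (Complex.exp (Complex.I * x)) A‖ ^ 2 ≤
        M * exp (-2 * |n * x| ^ γ) := by
  obtain ⟨hγ0, hγ1⟩ := hγ
  obtain ⟨β, hγβ, hβ1⟩ := exists_between hγ1
  have hβ0 : 0 < β := hγ0.trans hγβ
  have hr : 1 < β⁻¹ := (one_lt_inv₀ hβ0).2 hβ1
  have hsum : Summable fun k : ℕ ↦ (((k + 1 : ℕ) : ℝ) ^ β⁻¹)⁻¹ :=
    (summable_nat_add_iff 1).2 (Real.summable_nat_rpow_inv.2 hr)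
  set S : ℝ := ∑' k : ℕ, (((k + 1 : ℕ) : ℝ) ^ β⁻¹)⁻¹ with hS
  have hS0 : 0 ≤ S := tsum_nonneg fun k ↦ by positivity
  set a : ℝ := (S + 1)⁻¹ with ha
  have ha0 : 0 < a := by positivity
  have ha1 : a ≤ 1 := inv_le_one_of_one_le₀ (by linarith)
  have haS : a * S < 1 := by
    rw [ha, inv_mul_lt_iff₀ (by positivity)]
    linarith
  set b : ℝ := a / (π * exp 1) with hb
  have hb0 : 0 < b := by positivity
  obtain ⟨D, hD⟩ := exists_rpow_le_mul_rpow_add hγ0 hγβ (rpow_pos_of_pos hb0 β)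
  refine ⟨exp (2 * (1 + D)), exp_pos _, fun n hn ↦ ?_⟩
  have hn0 : (0 : ℝ) < n := by exact_mod_cast hn
  set m : ℕ → ℕ := fun k ↦ ⌈a * n / ((k + 1 : ℕ) : ℝ) ^ β⁻¹⌉₊ with hm
  have hmpos : ∀ k, 0 < m k := fun k ↦ Nat.ceil_pos.2 (by positivity)
  refine ⟨∏ k ∈ Finset.range n, averagePolynomial (m k), ?_, ?_, fun x hx ↦ ?_⟩
  · have h1 : (∏ k ∈ Finset.range n, averagePolynomial (m k)).natDegree ≤
        ∑ k ∈ Finset.range n, (m k - 1) :=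
      (Polynomial.natDegree_prod_le _ _).trans
        (Finset.sum_le_sum fun k _ ↦ natDegree_averagePolynomial_le _)
    have h2 : ((∑ k ∈ Finset.range n, (m k - 1) : ℕ) : ℝ) ≤ a * n * S := by
      push_cast
      calc ∑ k ∈ Finset.range n, ((m k - 1 : ℕ) : ℝ)
          ≤ ∑ k ∈ Finset.range n, a * n * (((k + 1 : ℕ) : ℝ) ^ β⁻¹)⁻¹ := by
            refine Finset.sum_le_sum fun k _ ↦ ?_
            rw [Nat.cast_sub (hmpos k), Nat.cast_one, ← div_eq_mul_inv]
            have : (m k : ℝ) < _ :=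
              Nat.ceil_lt_add_one (a := a * n / ((k + 1 : ℕ) : ℝ) ^ β⁻¹) (by positivity)
            linarith
        _ ≤ a * n * S := by
            rw [← Finset.mul_sum]
            gcongr
            exact hsum.sum_le_tsum _ fun k _ ↦ by positivity
    have h3 : a * n * S < n := by nlinarith
    exact h1.trans_lt (by exact_mod_cast h2.trans_lt h3)
  · rw [Polynomial.eval_prod]
    exact Finset.prod_eq_one fun k _ ↦ eval_one_averagePolynomial (hmpos k).ne'
  · set t : ℝ := |n * x| with ht
    have htx : t = n * |x| := by rw [ht, abs_mul, Nat.abs_cast]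
    have ht0 : 0 ≤ t := abs_nonneg _
    set L : ℕ := ⌊(b * t) ^ β⌋₊ with hL
    have hbt : b * t ≤ n := by
      have h1 : 1 ≤ exp 1 := one_le_exp zero_le_one
      rw [hb, htx, div_mul_eq_mul_div, div_le_iff₀ (by positivity)]
      calc a * (n * |x|) ≤ 1 * (n * π) := by gcongr
        _ = n * (π * 1) := by ring
        _ ≤ n * (π * exp 1) := by gcongr
    have hLn : L ≤ n := by
      refine Nat.floor_le_of_le ?_
      calc (b * t) ^ β ≤ (n : ℝ) ^ β := by gcongr
        _ ≤ (n : ℝ) ^ (1 : ℝ) := by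
          gcongr
          exact_mod_cast hn
        _ = n := rpow_one _
    have hfactor : ∀ k < L, ‖Polynomial.aeval (Complex.exp (Complex.I * x))
        (averagePolynomial (m k))‖ ≤ exp (-1) := by
      intro k hk
      have h1 : ((k + 1 : ℕ) : ℝ) ≤ (b * t) ^ β :=
        (Nat.cast_le.2 hk).trans (Nat.floor_le (by positivity))
      have h2 : ((k + 1 : ℕ) : ℝ) ^ β⁻¹ ≤ b * t :=
        (rpow_inv_le_iff_of_pos (by positivity) (by positivity) hβ0).2 h1
      have hw : 0 < ((k + 1 : ℕ) : ℝ) ^ β⁻¹ := by positivity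
      have htpos : 0 < t := by
        have := hw.trans_le h2
        exact pos_of_mul_pos_right this hb0.le
      have hx0 : x ≠ 0 := by
        rintro rfl
        simp [ht] at htpos
      have hxpos : 0 < |x| := abs_pos.2 hx0
      refine (norm_aeval_averagePolynomial_le (hmpos k).ne' hx0 hx).trans ?_
      have h3 : a * n / ((k + 1 : ℕ) : ℝ) ^ β⁻¹ ≤ m k := Nat.le_ceil _
      have hmk : (0 : ℝ) < m k := by exact_mod_cast hmpos k
      rw [div_le_iff₀ (by positivity)]
      have h4 : a * n / (b * t) * |x| ≤ m k * |x| := by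
        gcongr
        exact le_trans (by gcongr) h3
      have h5 : a * n / (b * t) * |x| = π * exp 1 := by
        rw [hb, htx]
        field_simp
      rw [h5] at h4
      rw [exp_neg, ← div_eq_inv_mul, le_div_iff₀ (exp_pos 1)]
      exact h4
    have hprod : ‖Polynomial.aeval (Complex.exp (Complex.I * x))
        (∏ k ∈ Finset.range n, averagePolynomial (m k))‖ ≤ exp (-L) := by
      rw [map_prod, norm_prod, ← Finset.prod_range_mul_prod_Ico _ hLn]
      calc _ ≤ (∏ k ∈ Finset.range L, exp (-1)) * 1 := by
            refine mul_le_mul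
              (Finset.prod_le_prod (fun k _ ↦ norm_nonneg _)
                fun k hk ↦ hfactor k (Finset.mem_range.1 hk))
              (Finset.prod_le_one (fun k _ ↦ norm_nonneg _) fun k _ ↦
                norm_aeval_averagePolynomial_le_one _ (Complex.norm_exp_I_mul_ofReal x))
              (Finset.prod_nonneg fun k _ ↦ norm_nonneg _)
              (Finset.prod_nonneg fun k _ ↦ (exp_pos _).le)
        _ = exp (-L) := by
            rw [Finset.prod_const, Finset.card_range, ← exp_nat_mul, mul_one]
            ring_nf
    have hfl : (b * t) ^ β < L + 1 := Nat.lt_floor_add_one _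
    rw [mul_rpow hb0.le ht0] at hfl
    have hDt := hD t ht0
    calc _ ≤ exp (-L) ^ 2 := by gcongr
      _ = exp (2 * -L) := by rw [← exp_nat_mul]; norm_num
      _ ≤ exp (2 * (1 + D) + -2 * t ^ γ) := exp_le_exp.2 (by linarith)
      _ = _ := exp_add _ _

/-- Existence of well-concentrated trigonometric polynomials: for every `γ ∈ (0,1)`
there is `C = C(γ)` such that for every `n ≥ 1` there is a trigonometric polynomial
`q(x) = Σ_{|ℓ|<n} c_ℓ e^{iℓx}` with `c_0 = 1`, `∫_{-π}^{π} |q| ≤ C`, and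
`∫_{s/n ≤ |x| ≤ π} |q| ≤ C s^{1-γ} e^{-s^γ}` for all `s ≥ 1`. -/
theorem stmt17 (γ : ℝ) (hγ : γ ∈ Set.Ioo (0 : ℝ) 1) :
    ∃ C : ℝ, 0 < C ∧ ∀ n : ℕ, 1 ≤ n → ∃ c : ℤ → ℂ,
      (∀ ℓ : ℤ, (n : ℤ) ≤ |ℓ| → c ℓ = 0) ∧ c 0 = 1 ∧
      (∫ x in Set.Icc (-π) π,
          ‖∑ ℓ ∈ Finset.Icc (-(n : ℤ) + 1) ((n : ℤ) - 1),
            c ℓ * Complex.exp (Complex.I * ℓ * x)‖) ≤ C ∧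
      ∀ s : ℝ, 1 ≤ s →
        (∫ x in {x : ℝ | s / n ≤ |x| ∧ |x| ≤ π},
            ‖∑ ℓ ∈ Finset.Icc (-(n : ℤ) + 1) ((n : ℤ) - 1),
              c ℓ * Complex.exp (Complex.I * ℓ * x)‖) ≤
          C * s ^ (1 - γ) * Real.exp (-s ^ γ) := by
  obtain ⟨M, hM, hA⟩ := exists_polynomial_norm_sq_le hγ
  obtain ⟨hγ0, hγ1⟩ := hγ
  have hint := integrable_exp_neg_abs_rpow hγ0
  set E : ℝ := ∫ x : ℝ, exp (-|x| ^ γ) with hE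
  have hE0 : 0 < E := integral_exp_pos hint
  refine ⟨M * E, by positivity, fun n hn ↦ ?_⟩
  have hn0 : (0 : ℝ) < n := by exact_mod_cast hn
  obtain ⟨A, hdeg, h1, hbound⟩ := hA n hn
  obtain ⟨c, hc, hc0, hcA⟩ := exists_coeff_of_polynomial hn A hdeg h1
  have hintn : Integrable fun x : ℝ ↦ exp (-|n * x| ^ γ) := hint.comp_mul_left' hn0.ne'
  have hEn : ∫ x : ℝ, exp (-|n * x| ^ γ) = (n : ℝ)⁻¹ * E := by
    rw [Measure.integral_comp_mul_left (fun y : ℝ ↦ exp (-|y| ^ γ)), abs_of_pos (by positivity),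
      smul_eq_mul]
  have hcont : Continuous fun x : ℝ ↦ ‖∑ ℓ ∈ Finset.Icc (-(n : ℤ) + 1) ((n : ℤ) - 1),
      c ℓ * Complex.exp (Complex.I * ℓ * x)‖ := by fun_prop
  have tail : ∀ u : ℝ, 0 ≤ u → ∀ T : Set ℝ, IsClosed T → T ⊆ Set.Icc (-π) π →
      (∀ x ∈ T, u ≤ |n * x|) →
      (∫ x in T, ‖∑ ℓ ∈ Finset.Icc (-(n : ℤ) + 1) ((n : ℤ) - 1),
        c ℓ * Complex.exp (Complex.I * ℓ * x)‖) ≤ M * E * exp (-u ^ γ) := by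
    intro u hu T hTc hT hTu
    have hg : Integrable fun x : ℝ ↦ n * M * exp (-u ^ γ) * exp (-|n * x| ^ γ) :=
      hintn.const_mul _
    calc _ ≤ ∫ x in T, n * M * exp (-u ^ γ) * exp (-|n * x| ^ γ) := by
          refine setIntegral_mono_on
            ((hcont.continuousOn.integrableOn_compact isCompact_Icc).mono_set hT)
            hg.integrableOn hTc.measurableSet fun x hx ↦ ?_
          refine (hcA x).trans ?_
          have hle : u ^ γ ≤ |n * x| ^ γ := rpow_le_rpow hu (hTu x hx) hγ0.le
          rw [mul_assoc, mul_assoc, ← exp_add]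
          gcongr
          refine (hbound x (abs_le.2 (hT hx))).trans ?_
          gcongr
          linarith
      _ ≤ ∫ x : ℝ, n * M * exp (-u ^ γ) * exp (-|n * x| ^ γ) :=
          setIntegral_le_integral hg (Filter.Eventually.of_forall fun x ↦ by positivity)
      _ = M * E * exp (-u ^ γ) := by
          rw [integral_const_mul, hEn]
          field_simp
  refine ⟨c, hc, hc0, ?_, fun s hs ↦ ?_⟩
  · have h := tail 0 le_rfl _ isClosed_Icc subset_rfl fun x _ ↦ abs_nonneg _
    rwa [zero_rpow hγ0.ne', neg_zero, exp_zero, mul_one] at h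
  · have hs0 : 0 ≤ s := zero_le_one.trans hs
    refine (tail s hs0 {x : ℝ | s / n ≤ |x| ∧ |x| ≤ π} ?_ (fun x hx ↦ abs_le.1 hx.2)
      fun x hx ↦ ?_).trans ?_
    · exact (isClosed_le continuous_const continuous_abs).inter
        (isClosed_le continuous_abs continuous_const)
    · rw [abs_mul, Nat.abs_cast, ← div_le_iff₀' hn0]
      exact hx.1
    · have h1s : 1 ≤ s ^ (1 - γ) := one_le_rpow hs (by linarith)
      exact mul_le_mul_of_nonneg_right (le_mul_of_one_le_right (by positivity) h1s) (exp_pos _).le
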